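/- There exists a primitive recursive function W : ℕ × ℕ → List ℕ such that, defining for each n the set U n = { f : ℕ → ℕ | ∃ s, W (n, s) is an initial segment of f }, every U n is a dense open subset of Baire space ℕ → ℕ, and no element of the intersection of all the U n is dominated by a primitive recursive function: for every f : ℕ → ℕ with f ∈ U n for all n and every primitive recursive g : ℕ → ℕ, there exists i with f i > g i. -/

import Mathlib

/-- `σ` is an initial segment of `f`: `f i` equals the `i`-th entry of `σ`
for every `i < σ.length`. -/
def IsInitialSegment (σ : List ℕ) (f : ℕ → ℕ) : Prop :=
  ∀ i : Fin σ.length, σ.get i = f i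

open Nat.Partrec (Code)

theorem isOpen_isInitialSegment (σ : List ℕ) : IsOpen {f : ℕ → ℕ | IsInitialSegment σ f} := by
  have h : {f : ℕ → ℕ | IsInitialSegment σ f} =
      ⋂ i : Fin σ.length, (fun f : ℕ → ℕ => f i) ⁻¹' {σ.get i} := by
    ext f
    simp [IsInitialSegment, eq_comm]
  rw [h]
  exact isOpen_iInter_of_finite fun i => (isOpen_discrete _).preimage (continuous_apply _)

theorem IsInitialSegment.apply_length {σ : List ℕ} {v : ℕ} {f : ℕ → ℕ}
    (h : IsInitialSegment (σ ++ [v]) f) : f σ.length = v := by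
  simpa using (h ⟨σ.length, by simp⟩).symm

theorem isInitialSegment_map_range_append (f : ℕ → ℕ) (N v : ℕ) :
    IsInitialSegment ((List.range N).map f ++ [v]) (Function.update f N v) := by
  rintro ⟨i, hi⟩
  have hi' : i < N + 1 := by simpa using hi
  rcases Nat.lt_succ_iff_lt_or_eq.1 hi' with h | rfl
  · simp [h, h.ne]
  · simp

/-- `k` steps of computation of `ack m i`. -/
def ackStage (m k i : ℕ) : Option ℕ :=
  Code.evaln k (Code.pappAck m) i

theorem primrec_ackStage : Primrec fun a : ℕ × ℕ × ℕ => ackStage a.1 a.2.1 a.2.2 :=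
  Code.primrec_evaln.comp
    (((Primrec.fst.comp Primrec.snd).pair (Code.primrec_pappAck.comp Primrec.fst)).pair
      (Primrec.snd.comp Primrec.snd))

theorem eq_ack_of_ackStage_eq_some {m k i v : ℕ} (h : ackStage m k i = some v) :
    v = ack m i := by
  have h' := Code.evaln_sound (Option.mem_def.2 h)
  rw [Code.eval_pappAck] at h'
  exact Part.mem_some_iff.1 h'

theorem exists_ackStage_eq_some (m i : ℕ) : ∃ k, ackStage m k i = some (ack m i) :=
  Code.evaln_complete.1 (by rw [Code.eval_pappAck]; exact Part.mem_some _)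

/-- The strings generating the `n`-th dense open set, where `n` codes a pair `(m, k)`. If `ack m 0`
is not computed within `k` steps, every string is empty. Otherwise every string ends with the value
of `ack m` at the last position; the string `[ack m 0]` is used by default when the
computation of the last entry takes too long. -/
def ackEscape (p : ℕ × ℕ) : List ℕ :=
  (ackStage p.1.unpair.1 p.1.unpair.2 0).elim [] fun v =>
    (ackStage p.1.unpair.1 p.2.unpair.2 (Denumerable.ofNat (List ℕ) p.2.unpair.1).length).elim [v]
      fun w => Denumerable.ofNat (List ℕ) p.2.unpair.1 ++ [w]

theorem primrec_ackEscape : Primrec ackEscape := by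
  have hm : Primrec fun p : ℕ × ℕ => p.1.unpair.1 :=
    Primrec.fst.comp (Primrec.unpair.comp Primrec.fst)
  have hk : Primrec fun p : ℕ × ℕ => p.1.unpair.2 :=
    Primrec.snd.comp (Primrec.unpair.comp Primrec.fst)
  have hσ : Primrec fun p : ℕ × ℕ => Denumerable.ofNat (List ℕ) p.2.unpair.1 :=
    (Primrec.ofNat _).comp (Primrec.fst.comp (Primrec.unpair.comp Primrec.snd))
  have hj : Primrec fun p : ℕ × ℕ => p.2.unpair.2 :=
    Primrec.snd.comp (Primrec.unpair.comp Primrec.snd)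
  have hfirst : Primrec fun p : ℕ × ℕ => ackStage p.1.unpair.1 p.1.unpair.2 0 :=
    primrec_ackStage.comp (hm.pair (hk.pair (Primrec.const 0)))
  have hlast : Primrec fun p : ℕ × ℕ => ackStage p.1.unpair.1 p.2.unpair.2
      (Denumerable.ofNat (List ℕ) p.2.unpair.1).length :=
    primrec_ackStage.comp (hm.pair (hj.pair (Primrec.list_length.comp hσ)))
  have hbranch : Primrec₂ fun (p : ℕ × ℕ) (v : ℕ) =>
      (ackStage p.1.unpair.1 p.2.unpair.2
        (Denumerable.ofNat (List ℕ) p.2.unpair.1).length).elim [v]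
        fun w => Denumerable.ofNat (List ℕ) p.2.unpair.1 ++ [w] := by
    refine (Primrec.option_casesOn (hlast.comp Primrec.fst)
      (Primrec.list_cons.comp Primrec.snd (Primrec.const []))
      (Primrec.list_concat.comp (hσ.comp (Primrec.fst.comp Primrec.fst)) Primrec.snd).to₂).of_eq
      fun a => ?_
    dsimp only
    cases ackStage a.1.1.unpair.1 a.1.2.unpair.2
      (Denumerable.ofNat (List ℕ) a.1.2.unpair.1).length <;> rfl
  refine (Primrec.option_casesOn hfirst (Primrec.const []) hbranch).of_eq fun p => ?_
  unfold ackEscape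
  cases ackStage p.1.unpair.1 p.1.unpair.2 0 <;> rfl

theorem exists_ackEscape_eq_append (n : ℕ) (σ : List ℕ)
    (hn : ackStage n.unpair.1 n.unpair.2 0 ≠ none) :
    ∃ s, ackEscape (n, s) = σ ++ [ack n.unpair.1 σ.length] := by
  obtain ⟨v, hv⟩ := Option.ne_none_iff_exists'.1 hn
  obtain ⟨j, hj⟩ := exists_ackStage_eq_some n.unpair.1 σ.length
  exact ⟨Nat.pair (Encodable.encode σ) j, by simp [ackEscape, hv, hj]⟩

theorem exists_ackEscape_eq_append_ack (m : ℕ) :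
    ∃ n, ∀ s, ∃ σ : List ℕ, ackEscape (n, s) = σ ++ [ack m σ.length] := by
  obtain ⟨k, hk⟩ := exists_ackStage_eq_some m 0
  refine ⟨Nat.pair m k, fun s => ?_⟩
  rcases hlast : ackStage m s.unpair.2 (Denumerable.ofNat (List ℕ) s.unpair.1).length with _ | w
  · exact ⟨[], by simp [ackEscape, hk, hlast]⟩
  · refine ⟨Denumerable.ofNat (List ℕ) s.unpair.1, ?_⟩
    simp [ackEscape, hk, hlast, eq_ack_of_ackStage_eq_some hlast]

theorem dense_ackEscape (n : ℕ) :
    Dense {f : ℕ → ℕ | ∃ s, IsInitialSegment (ackEscape (n, s)) f} := by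
  by_cases hn : ackStage n.unpair.1 n.unpair.2 0 = none
  · convert dense_univ
    refine Set.eq_univ_of_forall fun f => ⟨0, ?_⟩
    have hnil : ackEscape (n, 0) = [] := by simp [ackEscape, hn]
    rw [hnil]
    exact fun i => i.elim0
  · rw [(PiNat.isTopologicalBasis_cylinders fun _ : ℕ => ℕ).dense_iff]
    rintro _ ⟨f, N, rfl⟩ -
    obtain ⟨s, hs⟩ := exists_ackEscape_eq_append n ((List.range N).map f) hn
    exact ⟨_, PiNat.update_mem_cylinder f N _, s, hs ▸ isInitialSegment_map_range_append f N _⟩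

theorem stmt1 :
    ∃ W : ℕ × ℕ → List ℕ, Primrec W ∧
      (∀ n : ℕ, IsOpen {f : ℕ → ℕ | ∃ s, IsInitialSegment (W (n, s)) f}) ∧
      (∀ n : ℕ, Dense {f : ℕ → ℕ | ∃ s, IsInitialSegment (W (n, s)) f}) ∧
      (∀ f : ℕ → ℕ, (∀ n, f ∈ {g : ℕ → ℕ | ∃ s, IsInitialSegment (W (n, s)) g}) →
        ∀ g : ℕ → ℕ, Primrec g → ∃ i, g i < f i) := by
  refine ⟨ackEscape, primrec_ackEscape, fun n => ?_, dense_ackEscape, fun f hf g hg => ?_⟩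
  · simp only [Set.ofPred_exists]
    exact isOpen_iUnion fun s => isOpen_isInitialSegment _
  · obtain ⟨m, hm⟩ := exists_lt_ack_of_nat_primrec (Primrec.nat_iff.1 hg)
    obtain ⟨n, hn⟩ := exists_ackEscape_eq_append_ack m
    obtain ⟨s, hs⟩ := hf n
    obtain ⟨σ, hσ⟩ := hn s
    rw [hσ] at hs
    exact ⟨σ.length, hs.apply_length ▸ hm σ.length⟩
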